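/- For every ε > 0 there exists x₀ such that the following holds for all x ≥ x₀: let B₀ be either 1 or a prime with B₀ ≤ x, and set P := (∏_{p ≤ x, p prime} p)/B₀. Then for every real Z ≥ P and every integer b with 1 ≤ b ≤ PZ and gcd(b, P) = 1, #{z ∈ ℤ : 1 ≤ z ≤ Z and Pz + b is prime} ≤ (4e^{γ} + ε)·(log x/log Z)·Z. -/

import Mathlib

open Real

/-- `primorialBelow x` is the product of all primes `p ≤ x`. -/
noncomputable def primorialBelow (x : ℝ) : ℕ :=
  ∏ p ∈ Finset.filter Nat.Prime (Finset.range (⌊x⌋₊ + 1)), p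

/-- The squarefree integers in `[1, R]` that are coprime to `q`. -/
def sieveSupport (q R : ℕ) : Finset ℕ :=
  {d ∈ Finset.Icc 1 R | Squarefree d ∧ d.Coprime q}

lemma mem_sieveSupport {q R d : ℕ} :
    d ∈ sieveSupport q R ↔ (1 ≤ d ∧ d ≤ R) ∧ Squarefree d ∧ d.Coprime q := by
  simp [sieveSupport]

lemma mem_sieveSupport_of_dvd {q R d e : ℕ} (hd : d ∈ sieveSupport q R) (h : e ∣ d) :
    e ∈ sieveSupport q R := by
  rw [mem_sieveSupport] at hd ⊢
  obtain ⟨⟨h1, h2⟩, h3, h4⟩ := hd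
  exact ⟨⟨Nat.pos_of_dvd_of_pos h h1, (Nat.le_of_dvd h1 h).trans h2⟩,
    h3.squarefree_of_dvd h, h4.coprime_dvd_left h⟩

lemma one_mem_sieveSupport {q R : ℕ} (hR : 1 ≤ R) : 1 ∈ sieveSupport q R := by
  simp [mem_sieveSupport, hR]

/-- The sum of `1 / φ(l)` over the support of the sieve. -/
noncomputable def sieveMass (q R : ℕ) : ℝ :=
  ∑ l ∈ sieveSupport q R, ((l.totient : ℝ))⁻¹

lemma totient_pos_of_mem {q R d : ℕ} (hd : d ∈ sieveSupport q R) : (0 : ℝ) < d.totient := by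
  rw [mem_sieveSupport] at hd
  exact_mod_cast Nat.totient_pos.2 hd.1.1

lemma sieveMass_pos {q R : ℕ} (hR : 1 ≤ R) : 0 < sieveMass q R :=
  Finset.sum_pos (fun _ hl => inv_pos.2 (totient_pos_of_mem hl)) ⟨1, one_mem_sieveSupport hR⟩

/-- Selberg's weights. -/
noncomputable def selbergWeight (q R d : ℕ) : ℝ :=
  d / sieveMass q R * ∑ l ∈ sieveSupport q R with d ∣ l,
    (ArithmeticFunction.moebius (l / d) : ℝ) * ArithmeticFunction.moebius l / l.totient

lemma moebius_sq_of_mem {q R l : ℕ} (hl : l ∈ sieveSupport q R) :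
    (ArithmeticFunction.moebius l : ℝ) * ArithmeticFunction.moebius l = 1 := by
  have := ArithmeticFunction.moebius_sq_eq_one_of_squarefree (mem_sieveSupport.1 hl).2.1
  rw [sq] at this
  exact_mod_cast this

lemma selbergWeight_one {q R : ℕ} (hR : 1 ≤ R) : selbergWeight q R 1 = 1 := by
  have hJ := sieveMass_pos (q := q) hR
  unfold selbergWeight
  have : ∑ l ∈ sieveSupport q R with 1 ∣ l,
      (ArithmeticFunction.moebius (l / 1) : ℝ) * ArithmeticFunction.moebius l / l.totient
      = sieveMass q R := by
    rw [sieveMass, Finset.filter_true_of_mem (by simp)]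
    refine Finset.sum_congr rfl fun l hl => ?_
    rw [Nat.div_one, moebius_sq_of_mem hl, one_div]
  rw [this]
  field_simp
  simp

lemma sum_moebius_div_between {q R l m : ℕ} (hm : m ∈ sieveSupport q R) :
    ∑ d ∈ sieveSupport q R with l ∣ d ∧ d ∣ m, (ArithmeticFunction.moebius (m / d) : ℝ)
      = if m = l then 1 else 0 := by
  have hm0 : m ≠ 0 := by have := (mem_sieveSupport.1 hm).1.1; omega
  by_cases hlm : l ∣ m
  · obtain ⟨n, rfl⟩ := hlm
    have hl0 : 0 < l := Nat.pos_of_ne_zero (by rintro rfl; simp at hm0)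
    have hn0 : n ≠ 0 := by rintro rfl; simp at hm0
    have key : ∑ d ∈ sieveSupport q R with l ∣ d ∧ d ∣ l * n,
        (ArithmeticFunction.moebius (l * n / d) : ℝ)
        = ∑ e ∈ n.divisors, (ArithmeticFunction.moebius (n / e) : ℝ) := by
      symm
      refine Finset.sum_bij (fun e _ => l * e) ?_ ?_ ?_ ?_
      · intro e he
        have he' : l * e ∣ l * n := Nat.mul_dvd_mul_left l (Nat.dvd_of_mem_divisors he)
        simp only [Finset.mem_filter]
        exact ⟨mem_sieveSupport_of_dvd hm he', dvd_mul_right _ _, he'⟩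
      · intro a _ b _ h
        exact Nat.eq_of_mul_eq_mul_left hl0 h
      · intro d hd
        simp only [Finset.mem_filter] at hd
        obtain ⟨_, ⟨e, rfl⟩, h⟩ := hd
        exact ⟨e, Nat.mem_divisors.2 ⟨(Nat.mul_dvd_mul_iff_left hl0).1 h, hn0⟩, rfl⟩
      · intro e _
        rw [Nat.mul_div_mul_left _ _ hl0]
    rw [key, Nat.sum_div_divisors n (fun e => (ArithmeticFunction.moebius e : ℝ))]
    have h : ∑ e ∈ n.divisors, (ArithmeticFunction.moebius e : ℝ) = if n = 1 then 1 else 0 := by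
      have h := congrArg (fun f => f n) ArithmeticFunction.moebius_mul_coe_zeta
      simp only [ArithmeticFunction.coe_mul_zeta_apply, ArithmeticFunction.one_apply] at h
      exact_mod_cast h
    rw [h]
    have : l * n = l ↔ n = 1 := by
      constructor
      · intro h
        exact Nat.eq_of_mul_eq_mul_left hl0 (by rw [h, mul_one])
      · rintro rfl
        exact mul_one l
    simp only [this]
  · rw [Finset.sum_eq_zero, if_neg]
    · rintro rfl; exact hlm dvd_rfl
    · intro d hd
      simp only [Finset.mem_filter] at hd
      exact absurd (hd.2.1.trans hd.2.2) hlm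

lemma sum_selbergWeight_div {q R l : ℕ} (hl : l ∈ sieveSupport q R) :
    ∑ d ∈ sieveSupport q R with l ∣ d, selbergWeight q R d / d
      = ArithmeticFunction.moebius l / (l.totient * sieveMass q R) := by
  calc ∑ d ∈ sieveSupport q R with l ∣ d, selbergWeight q R d / d
      = ∑ d ∈ sieveSupport q R, ∑ m ∈ sieveSupport q R, if l ∣ d ∧ d ∣ m then
        (ArithmeticFunction.moebius m / (m.totient * sieveMass q R) : ℝ) *
          ArithmeticFunction.moebius (m / d) else 0 := by
        rw [Finset.sum_filter]
        refine Finset.sum_congr rfl fun d hd => ?_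
        have hd0 : (d : ℝ) ≠ 0 := by
          have := (mem_sieveSupport.1 hd).1.1
          positivity
        split_ifs with h
        · simp only [h, true_and]
          rw [← Finset.sum_filter, selbergWeight, Finset.mul_sum, Finset.sum_div]
          refine Finset.sum_congr rfl fun m _ => ?_
          field_simp
        · simp [h]
    _ = ∑ m ∈ sieveSupport q R, (ArithmeticFunction.moebius m / (m.totient * sieveMass q R) : ℝ)
        * if m = l then 1 else 0 := by
        rw [Finset.sum_comm]
        refine Finset.sum_congr rfl fun m hm => ?_
        rw [← sum_moebius_div_between hm, Finset.mul_sum, Finset.sum_filter]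
    _ = _ := by simp [hl]

lemma sum_selbergWeight_div_lcm {q R : ℕ} (hR : 1 ≤ R) :
    ∑ d ∈ sieveSupport q R, ∑ e ∈ sieveSupport q R,
      selbergWeight q R d * selbergWeight q R e / (d.lcm e : ℝ) = (sieveMass q R)⁻¹ := by
  have hJ := sieveMass_pos (q := q) hR
  have hgcd : ∀ d ∈ sieveSupport q R, ∀ e : ℕ,
      ((d.gcd e : ℕ) : ℝ) = ∑ l ∈ sieveSupport q R, if l ∣ d ∧ l ∣ e then (l.totient : ℝ) else 0 := by
    intro d hd e
    have hd0 := (mem_sieveSupport.1 hd).1.1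
    rw [← Finset.sum_filter]
    conv_lhs => rw [← Nat.sum_totient (d.gcd e)]
    push_cast
    refine Finset.sum_congr ?_ fun _ _ => rfl
    ext l
    simp only [Nat.mem_divisors, Finset.mem_filter, Nat.dvd_gcd_iff]
    constructor
    · rintro ⟨h, _⟩
      exact ⟨mem_sieveSupport_of_dvd hd h.1, h⟩
    · rintro ⟨_, h⟩
      exact ⟨h, (Nat.gcd_pos_of_pos_left _ hd0).ne'⟩
  calc ∑ d ∈ sieveSupport q R, ∑ e ∈ sieveSupport q R,
        selbergWeight q R d * selbergWeight q R e / (d.lcm e : ℝ)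
      = ∑ d ∈ sieveSupport q R, ∑ e ∈ sieveSupport q R, ∑ l ∈ sieveSupport q R,
          (l.totient : ℝ) * ((if l ∣ d then selbergWeight q R d / d else 0)
            * (if l ∣ e then selbergWeight q R e / e else 0)) := by
        refine Finset.sum_congr rfl fun d hd => Finset.sum_congr rfl fun e he => ?_
        have hd0 : (d : ℝ) ≠ 0 := by
          have := (mem_sieveSupport.1 hd).1.1
          positivity
        have he0 : (e : ℝ) ≠ 0 := by
          have := (mem_sieveSupport.1 he).1.1
          positivity
        have hl : (d.lcm e : ℝ) ≠ 0 := by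
          have h1 := (mem_sieveSupport.1 hd).1.1
          have h2 := (mem_sieveSupport.1 he).1.1
          exact_mod_cast (Nat.lcm_pos h1 h2).ne'
        have hmul : ((d.gcd e : ℕ) : ℝ) * (d.lcm e : ℝ) = d * e := by
          exact_mod_cast Nat.gcd_mul_lcm d e
        have : selbergWeight q R d * selbergWeight q R e / (d.lcm e : ℝ)
            = (d.gcd e : ℕ) * (selbergWeight q R d / d * (selbergWeight q R e / e)) := by
          field_simp
          rw [mul_assoc, ← hmul]
          ring
        rw [this, hgcd d hd e, Finset.sum_mul]
        refine Finset.sum_congr rfl fun l _ => ?_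
        by_cases h1 : l ∣ d <;> by_cases h2 : l ∣ e <;> simp [h1, h2]
    _ = ∑ l ∈ sieveSupport q R, (l.totient : ℝ) *
          (∑ d ∈ sieveSupport q R with l ∣ d, selbergWeight q R d / d) ^ 2 := by
        simp_rw [Finset.sum_comm (t := sieveSupport q R)
          (f := fun e l => (Nat.totient l : ℝ) * _)]
        rw [Finset.sum_comm]
        refine Finset.sum_congr rfl fun l _ => ?_
        rw [sq, Finset.sum_filter, Finset.sum_mul_sum, Finset.mul_sum]
        refine Finset.sum_congr rfl fun d _ => ?_
        rw [Finset.mul_sum]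
    _ = ∑ l ∈ sieveSupport q R, ((l.totient : ℝ))⁻¹ / sieveMass q R ^ 2 := by
        refine Finset.sum_congr rfl fun l hl => ?_
        have h0 := totient_pos_of_mem hl
        rw [sum_selbergWeight_div hl, div_pow, sq (ArithmeticFunction.moebius l : ℝ),
          moebius_sq_of_mem hl]
        field_simp
    _ = _ := by
        rw [← Finset.sum_div, ← sieveMass]
        field_simp

lemma sum_divisors_inv_totient {d : ℕ} (hd : Squarefree d) :
    ∑ k ∈ d.divisors, ((k.totient : ℝ))⁻¹ = d / d.totient := by
  have hd0 : d ≠ 0 := hd.ne_zero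
  have hφ : (0 : ℝ) < d.totient := by exact_mod_cast Nat.totient_pos.2 (Nat.pos_of_ne_zero hd0)
  have h : ∑ k ∈ d.divisors, ((d / k).totient : ℝ) = d := by
    rw [Nat.sum_div_divisors d (fun k => (k.totient : ℝ))]
    exact_mod_cast Nat.sum_totient d
  rw [eq_div_iff hφ.ne', Finset.sum_mul]
  refine Eq.trans (Finset.sum_congr rfl fun k hk => ?_) h
  obtain ⟨m, rfl⟩ := Nat.dvd_of_mem_divisors hk
  have hk0 : 0 < k := Nat.pos_of_ne_zero (by rintro rfl; simp at hd0)
  have hφk : (0 : ℝ) < k.totient := by exact_mod_cast Nat.totient_pos.2 hk0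
  rw [Nat.totient_mul (Nat.coprime_of_squarefree_mul hd), Nat.mul_div_cancel_left _ hk0]
  push_cast
  field_simp

lemma abs_selbergWeight_le_one {q R d : ℕ} (hR : 1 ≤ R) (hd : d ∈ sieveSupport q R) :
    |selbergWeight q R d| ≤ 1 := by
  have hJ := sieveMass_pos (q := q) hR
  have hφ := totient_pos_of_mem hd
  have hd1 := (mem_sieveSupport.1 hd).1.1
  set T := {m ∈ Finset.Icc 1 R | d * m ∈ sieveSupport q R} with hT
  have hcop : ∀ m ∈ T, d.Coprime m := by
    intro m hm
    rw [hT, Finset.mem_filter] at hm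
    exact Nat.coprime_of_squarefree_mul (mem_sieveSupport.1 hm.2).2.1
  have h1 : ∑ l ∈ sieveSupport q R with d ∣ l, ((l.totient : ℝ))⁻¹
      = (d.totient : ℝ)⁻¹ * ∑ m ∈ T, ((m.totient : ℝ))⁻¹ := by
    rw [Finset.mul_sum]
    symm
    refine Finset.sum_bij (fun m _ => d * m) ?_ ?_ ?_ ?_
    · intro m hm
      rw [hT, Finset.mem_filter] at hm
      simp [hm.2]
    · intro a _ b _ h
      exact Nat.eq_of_mul_eq_mul_left hd1 h
    · intro l hl
      simp only [Finset.mem_filter] at hl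
      obtain ⟨hl, m, rfl⟩ := hl
      have hm := mem_sieveSupport.1 (mem_sieveSupport_of_dvd hl (dvd_mul_left m d))
      exact ⟨m, by rw [hT, Finset.mem_filter, Finset.mem_Icc]; exact ⟨hm.1, hl⟩, rfl⟩
    · intro m hm
      rw [Nat.totient_mul (hcop m hm)]
      push_cast
      rw [mul_inv]
  have h2 : (∑ k ∈ d.divisors, ((k.totient : ℝ))⁻¹) * ∑ m ∈ T, ((m.totient : ℝ))⁻¹
      ≤ sieveMass q R := by
    rw [Finset.sum_mul_sum, ← Finset.sum_product', sieveMass]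
    calc ∑ x ∈ d.divisors ×ˢ T, ((x.1.totient : ℝ))⁻¹ * ((x.2.totient : ℝ))⁻¹
        = ∑ l ∈ (d.divisors ×ˢ T).image (fun x => x.1 * x.2), ((l.totient : ℝ))⁻¹ := by
          rw [Finset.sum_image]
          · refine Finset.sum_congr rfl fun x hx => ?_
            rw [Finset.mem_product] at hx
            rw [Nat.totient_mul ((hcop _ hx.2).coprime_dvd_left (Nat.dvd_of_mem_divisors hx.1))]
            push_cast
            rw [mul_inv]
          · rintro ⟨a, b⟩ hx ⟨a', b'⟩ hy h
            simp only [Finset.coe_product, Set.mem_prod, Finset.mem_coe] at hx hy h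
            have hda := Nat.dvd_of_mem_divisors hx.1
            have hda' := Nat.dvd_of_mem_divisors hy.1
            have e : ∀ {a b}, a ∣ d → b ∈ T → d.gcd (a * b) = a := by
              intro a b ha hb
              rw [Nat.Coprime.gcd_mul_right_cancel_right _ (hcop b hb).symm]
              exact Nat.gcd_eq_right ha
            have haa : a = a' := by rw [← e hda hx.2, h, e hda' hy.2]
            subst haa
            have := Nat.pos_of_dvd_of_pos hda hd1
            rw [Nat.eq_of_mul_eq_mul_left this h]
      _ ≤ _ := by
          refine Finset.sum_le_sum_of_subset_of_nonneg ?_ fun _ _ _ => by positivity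
          intro l hl
          simp only [Finset.mem_image, Finset.mem_product] at hl
          obtain ⟨⟨a, b⟩, ⟨ha, hb⟩, rfl⟩ := hl
          rw [hT, Finset.mem_filter] at hb
          exact mem_sieveSupport_of_dvd hb.2
            (Nat.mul_dvd_mul_right (Nat.dvd_of_mem_divisors ha) b)
  rw [sum_divisors_inv_totient (mem_sieveSupport.1 hd).2.1] at h2
  have h3 : |∑ l ∈ sieveSupport q R with d ∣ l,
      (ArithmeticFunction.moebius (l / d) : ℝ) * ArithmeticFunction.moebius l / l.totient|
      ≤ ∑ l ∈ sieveSupport q R with d ∣ l, ((l.totient : ℝ))⁻¹ := by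
    refine (Finset.abs_sum_le_sum_abs _ _).trans (Finset.sum_le_sum fun l _ => ?_)
    have hμ : ∀ n, |(ArithmeticFunction.moebius n : ℝ)| ≤ 1 := fun n => by
      exact_mod_cast ArithmeticFunction.abs_moebius_le_one (n := n)
    rw [abs_div, abs_mul, Nat.abs_cast, ← one_div]
    gcongr
    exact mul_le_one₀ (hμ _) (abs_nonneg _) (hμ _)
  rw [selbergWeight, abs_mul, abs_of_nonneg (by positivity : 0 ≤ (d : ℝ) / sieveMass q R)]
  calc (d : ℝ) / sieveMass q R * _ ≤ d / sieveMass q R * ((d.totient : ℝ)⁻¹ * ∑ m ∈ T, ((m.totient : ℝ))⁻¹) := by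
        rw [← h1]; gcongr
    _ = (d / d.totient * ∑ m ∈ T, ((m.totient : ℝ))⁻¹) / sieveMass q R := by
        field_simp
    _ ≤ 1 := (div_le_one hJ).2 h2

lemma abs_card_dvd_sub_div_le {q d : ℕ} (hd : 1 ≤ d) (hdq : d.Coprime q) (b : ℤ) (N : ℕ) :
    |((({z ∈ Finset.Ioc (0 : ℤ) N | (d : ℤ) ∣ q * z + b}).card : ℝ)) - N / d| ≤ 1 := by
  obtain ⟨u, hu⟩ : ∃ u : ℤ, (d : ℤ) ∣ q * u - 1 := by
    have h : IsCoprime (q : ℤ) (d : ℤ) := Nat.isCoprime_iff_coprime.2 hdq.symm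
    obtain ⟨u, v, huv⟩ := h
    exact ⟨u, -v, by linear_combination huv⟩
  have hiff : ∀ z : ℤ, (d : ℤ) ∣ q * z + b ↔ z ≡ -b * u [ZMOD d] := by
    intro z
    obtain ⟨c, hc⟩ := hu
    rw [Int.modEq_comm, Int.modEq_iff_dvd]
    constructor
    · rintro ⟨k, hk⟩
      exact ⟨u * k - c * z, by linear_combination u * hk - z * hc⟩
    · rintro ⟨k, hk⟩
      exact ⟨q * k - c * b, by linear_combination (q : ℤ) * hk - b * hc⟩
  have hd0 : (0 : ℤ) < d := by exact_mod_cast hd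
  have hdR : (0 : ℝ) < d := by exact_mod_cast hd
  have h := Int.Ioc_filter_modEq_card (0 : ℤ) (N : ℤ) hd0 (-b * u)
  simp only [hiff]
  set v := -b * u
  have hmono : ⌊(((0 : ℤ) : ℚ) - v) / ((d : ℤ) : ℚ)⌋ ≤ ⌊(((N : ℤ) : ℚ) - v) / ((d : ℤ) : ℚ)⌋ := by
    gcongr
    exact_mod_cast Nat.zero_le N
  rw [max_eq_left (by linarith)] at h
  set f := ⌊(((N : ℤ) : ℚ) - v) / ((d : ℤ) : ℚ)⌋ with hf
  set g := ⌊(((0 : ℤ) : ℚ) - v) / ((d : ℤ) : ℚ)⌋ with hg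
  have hdQ : (0 : ℚ) < d := by exact_mod_cast hd
  have e : (((N : ℤ) : ℚ) - v) / ((d : ℤ) : ℚ) - (((0 : ℤ) : ℚ) - v) / ((d : ℤ) : ℚ) = N / d := by
    push_cast
    field_simp
    ring
  have h1 := Int.floor_le ((((N : ℤ) : ℚ) - v) / ((d : ℤ) : ℚ))
  have h2 := Int.lt_floor_add_one ((((N : ℤ) : ℚ) - v) / ((d : ℤ) : ℚ))
  have h3 := Int.floor_le ((((0 : ℤ) : ℚ) - v) / ((d : ℤ) : ℚ))
  have h4 := Int.lt_floor_add_one ((((0 : ℤ) : ℚ) - v) / ((d : ℤ) : ℚ))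
  rw [← hf] at h1 h2
  rw [← hg] at h3 h4
  have hQ : |((f - g : ℤ) : ℚ) - N / d| ≤ 1 := by
    rw [← e, abs_le]
    push_cast at *
    constructor <;> linarith
  have hR : |((f - g : ℤ) : ℝ) - N / d| ≤ 1 := by
    have := (Rat.cast_le (K := ℝ)).2 hQ
    push_cast at this ⊢
    exact this
  rw [← h] at hR
  exact_mod_cast hR

/-- **Selberg's sieve** for the arithmetic progression `q * z + b`. -/
theorem selberg_sieve_progression {q R : ℕ} (hR : 1 ≤ R) (b : ℤ) (N : ℕ) :
    (({z ∈ Finset.Ioc (0 : ℤ) N | ∀ d ∈ sieveSupport q R, (d : ℤ) ∣ q * z + b → d = 1}.card : ℝ))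
      ≤ N / sieveMass q R + (R : ℝ) ^ 2 := by
  set S := sieveSupport q R with hS
  set w := selbergWeight q R with hw
  have hw1 : w 1 = 1 := selbergWeight_one hR
  have hdvd : ∀ z : ℤ, (∑ d ∈ S with ((d : ℕ) : ℤ) ∣ q * z + b, w d) ^ 2
      = ∑ d ∈ S, ∑ e ∈ S, if ((d.lcm e : ℕ) : ℤ) ∣ q * z + b then w d * w e else 0 := by
    intro z
    rw [sq, Finset.sum_filter, Finset.sum_mul_sum]
    refine Finset.sum_congr rfl fun d _ => Finset.sum_congr rfl fun e _ => ?_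
    have : ((d.lcm e : ℕ) : ℤ) ∣ q * z + b ↔ (d : ℤ) ∣ q * z + b ∧ (e : ℤ) ∣ q * z + b := by
      simp only [Int.natCast_dvd, Nat.lcm_dvd_iff]
    by_cases h1 : (d : ℤ) ∣ q * z + b <;> by_cases h2 : (e : ℤ) ∣ q * z + b <;>
      simp [this, h1, h2]
  calc (({z ∈ Finset.Ioc (0 : ℤ) N | ∀ d ∈ S, (d : ℤ) ∣ q * z + b → d = 1}.card : ℝ))
      = ∑ z ∈ Finset.Ioc (0 : ℤ) N, if ∀ d ∈ S, (d : ℤ) ∣ q * z + b → d = 1 then (1 : ℝ) else 0 := by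
        simp
    _ ≤ ∑ z ∈ Finset.Ioc (0 : ℤ) N, (∑ d ∈ S with ((d : ℕ) : ℤ) ∣ q * z + b, w d) ^ 2 := by
        refine Finset.sum_le_sum fun z _ => ?_
        split_ifs with h
        · have : S.filter (fun d : ℕ => (d : ℤ) ∣ q * z + b) = {1} := by
            ext d
            simp only [Finset.mem_filter, Finset.mem_singleton]
            constructor
            · rintro ⟨h1, h2⟩
              exact h d h1 h2
            · rintro rfl
              exact ⟨one_mem_sieveSupport hR, by simp⟩
          rw [this, Finset.sum_singleton, hw1, one_pow]
        · positivity
    _ = ∑ d ∈ S, ∑ e ∈ S, w d * w e *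
          ({z ∈ Finset.Ioc (0 : ℤ) N | ((d.lcm e : ℕ) : ℤ) ∣ q * z + b}.card : ℝ) := by
        simp_rw [hdvd]
        rw [Finset.sum_comm]
        refine Finset.sum_congr rfl fun d _ => ?_
        rw [Finset.sum_comm]
        refine Finset.sum_congr rfl fun e _ => ?_
        rw [← Finset.sum_filter, Finset.sum_const, nsmul_eq_mul, mul_comm]
    _ ≤ ∑ d ∈ S, ∑ e ∈ S, (N * (w d * w e / (d.lcm e : ℝ)) + 1) := by
        refine Finset.sum_le_sum fun d hd => Finset.sum_le_sum fun e he => ?_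
        have hd' := mem_sieveSupport.1 hd
        have he' := mem_sieveSupport.1 he
        have hl : 1 ≤ d.lcm e := Nat.lcm_pos hd'.1.1 he'.1.1
        have hc : (d.lcm e).Coprime q :=
          (Nat.Coprime.mul_left hd'.2.2 he'.2.2).coprime_dvd_left (Nat.lcm_dvd_mul d e)
        have h1 := abs_card_dvd_sub_div_le hl hc b N
        have h2 : |w d * w e| ≤ 1 := by
          rw [abs_mul]
          exact mul_le_one₀ (abs_selbergWeight_le_one hR hd) (abs_nonneg _)
            (abs_selbergWeight_le_one hR he)
        have h3 := mul_le_one₀ h2 (abs_nonneg _) h1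
        rw [← abs_mul] at h3
        have h4 := (abs_le.1 h3).2
        have h5 : w d * w e * ((N : ℝ) / (d.lcm e : ℕ)) = N * (w d * w e / (d.lcm e : ℝ)) := by ring
        linarith [mul_sub (w d * w e)
          (({z ∈ Finset.Ioc (0 : ℤ) N | ((d.lcm e : ℕ) : ℤ) ∣ q * z + b}.card : ℝ))
          ((N : ℝ) / (d.lcm e : ℕ))]
    _ = N / sieveMass q R + (S.card : ℝ) ^ 2 := by
        simp only [Finset.sum_add_distrib, ← Finset.mul_sum]
        rw [sum_selbergWeight_div_lcm hR]
        simp [sq, div_eq_mul_inv]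
    _ ≤ N / sieveMass q R + (R : ℝ) ^ 2 := by
        have : S.card ≤ R := by
          simpa [hS, sieveSupport] using Finset.card_filter_le (Finset.Icc 1 R) (fun d => Squarefree d ∧ d.Coprime q)
        gcongr

lemma div_totient_eq_prod {n : ℕ} (hn : n ≠ 0) :
    (n : ℝ) / n.totient = ∏ p ∈ n.primeFactors, (1 - (p : ℝ)⁻¹)⁻¹ := by
  have h : (n.totient : ℝ) = n * ∏ p ∈ n.primeFactors, (1 - (p : ℝ)⁻¹) := by
    have := congrArg (fun x : ℚ => (x : ℝ)) (Nat.totient_eq_mul_prod_factors n)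
    push_cast at this
    exact this
  have hn' : (n : ℝ) ≠ 0 := by exact_mod_cast hn
  rw [h, Finset.prod_inv_distrib, ← div_div, div_self hn', one_div]

/-- The completely multiplicative function `n ↦ n ^ (-s)`. -/
noncomputable def rpowNegHom (s : ℝ) : ℕ →* ℝ where
  toFun n := (n : ℝ) ^ (-s)
  map_one' := by simp
  map_mul' a b := by
    push_cast
    exact Real.mul_rpow (Nat.cast_nonneg a) (Nat.cast_nonneg b)

lemma norm_rpowNegHom_lt_one {s : ℝ} (hs : 0 < s) {p : ℕ} (hp : p.Prime) :
    ‖rpowNegHom s p‖ < 1 := by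
  change ‖(p : ℝ) ^ (-s)‖ < 1
  rw [Real.norm_of_nonneg (by positivity)]
  exact Real.rpow_lt_one_of_one_lt_of_neg (by exact_mod_cast hp.one_lt) (by linarith)

lemma hasSum_factoredNumbers_rpow {s : ℝ} (hs : 0 < s) (A : Finset ℕ) :
    HasSum (fun m : Nat.factoredNumbers A => ((m : ℕ) : ℝ) ^ (-s))
      (∏ p ∈ A with p.Prime, (1 - (p : ℝ) ^ (-s))⁻¹) :=
  (EulerProduct.summable_and_hasSum_factoredNumbers_prod_filter_prime_geometric
    (f := rpowNegHom s) (norm_rpowNegHom_lt_one hs) A).2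

lemma sum_inv_le_of_primeFactors_subset {n : ℕ} (hn : n ≠ 0) (T : Finset ℕ)
    (hT : ∀ m ∈ T, m ≠ 0 ∧ m.primeFactors ⊆ n.primeFactors) :
    ∑ m ∈ T, (m : ℝ)⁻¹ ≤ n / n.totient := by
  have h := hasSum_factoredNumbers_rpow one_pos n.primeFactors
  have hf : (n.primeFactors.filter fun p => p.Prime) = n.primeFactors :=
    Finset.filter_true_of_mem fun p hp => Nat.prime_of_mem_primeFactors hp
  rw [hf] at h
  simp only [Real.rpow_neg_one] at h
  rw [← div_totient_eq_prod hn] at h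
  have hmem : ∀ m ∈ T, m ∈ Nat.factoredNumbers n.primeFactors := fun m hm =>
    Nat.mem_factoredNumbers_of_primeFactors_subset (hT m hm).1 (hT m hm).2
  have := sum_le_hasSum (T.subtype (· ∈ Nat.factoredNumbers n.primeFactors))
    (fun _ _ => by positivity) h
  refine le_trans (le_of_eq ?_) this
  rw [Finset.sum_subtype_of_mem (fun m : ℕ => (m : ℝ)⁻¹) hmem]

lemma log_le_sieveMass_mul {q R : ℕ} (hq : q ≠ 0) :
    Real.log (R + 1) ≤ sieveMass q R * (q / q.totient) := by
  have hφq : (0 : ℝ) < q.totient := by exact_mod_cast Nat.totient_pos.2 (Nat.pos_of_ne_zero hq)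
  let r : ℕ → ℕ := fun n => ∏ p ∈ n.primeFactors \ q.primeFactors, p
  have hrp : ∀ n, (r n).primeFactors = n.primeFactors \ q.primeFactors := fun n =>
    Nat.primeFactors_prod fun p hp =>
      Nat.prime_of_mem_primeFactors (Finset.mem_sdiff.1 hp).1
  have hr0 : ∀ n, r n ≠ 0 := fun n => Finset.prod_ne_zero_iff.2 fun p hp =>
    (Nat.prime_of_mem_primeFactors (Finset.mem_sdiff.1 hp).1).ne_zero
  have hrd : ∀ n, r n ∣ n := fun n =>
    (Finset.prod_dvd_prod_of_subset _ _ _ Finset.sdiff_subset).trans (Nat.prod_primeFactors_dvd n)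
  have hmaps : ∀ n ∈ Finset.Icc 1 R, r n ∈ sieveSupport q R := by
    intro n hn
    rw [Finset.mem_Icc] at hn
    rw [mem_sieveSupport]
    refine ⟨⟨Nat.pos_of_ne_zero (hr0 n), (Nat.le_of_dvd hn.1 (hrd n)).trans hn.2⟩, ?_, ?_⟩
    · have h1 : r n ∣ ∏ p ∈ n.primeFactors, p :=
        Finset.prod_dvd_prod_of_subset _ _ _ Finset.sdiff_subset
      refine Squarefree.squarefree_of_dvd h1 ?_
      refine Finset.squarefree_prod_of_pairwise_isCoprime ?_ ?_
      · intro a ha b hb hab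
        exact Nat.coprime_iff_isRelPrime.1 ((Nat.coprime_primes (Nat.prime_of_mem_primeFactors ha)
          (Nat.prime_of_mem_primeFactors hb)).2 hab)
      · intro p hp
        exact (Nat.prime_of_mem_primeFactors hp).prime.squarefree
    · rw [← Nat.disjoint_primeFactors (hr0 n) hq, hrp]
      exact Finset.sdiff_disjoint
  calc Real.log (R + 1) ≤ ∑ n ∈ Finset.Icc 1 R, (n : ℝ)⁻¹ := by
        have := log_add_one_le_harmonic R
        rw [harmonic_eq_sum_Icc] at this
        push_cast at this
        exact this
    _ = ∑ l ∈ sieveSupport q R, ∑ n ∈ Finset.Icc 1 R with r n = l, (n : ℝ)⁻¹ :=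
        (Finset.sum_fiberwise_of_maps_to hmaps _).symm
    _ ≤ ∑ l ∈ sieveSupport q R, ((l.totient : ℝ))⁻¹ * (q / q.totient) := by
        refine Finset.sum_le_sum fun l hl => ?_
        have hl' := mem_sieveSupport.1 hl
        have hl0 : l ≠ 0 := by have := hl'.1.1; omega
        have hlR : (0 : ℝ) < l := by have := hl'.1.1; positivity
        have hφl := totient_pos_of_mem hl
        have h1 : ∑ n ∈ Finset.Icc 1 R with r n = l, (n : ℝ)⁻¹
            = (l : ℝ)⁻¹ * ∑ m ∈ (Finset.Icc 1 R).filter (fun n => r n = l) |>.image (· / l),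
              (m : ℝ)⁻¹ := by
          have hdl : ∀ n ∈ (Finset.Icc 1 R).filter (fun n => r n = l), l ∣ n := by
            intro n hn
            rw [← (Finset.mem_filter.1 hn).2]
            exact hrd n
          rw [Finset.sum_image, Finset.mul_sum]
          · refine Finset.sum_congr rfl fun n hn => ?_
            rw [Nat.cast_div (hdl n hn) hlR.ne']
            field_simp
          · intro a ha b hb hab
            exact (Nat.div_left_inj (hdl a ha) (hdl b hb)).1 hab
        have h2 := sum_inv_le_of_primeFactors_subset (n := l * q) (mul_ne_zero hl0 hq)
          (((Finset.Icc 1 R).filter (fun n => r n = l)).image (· / l)) (by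
            intro m hm
            rw [Finset.mem_image] at hm
            obtain ⟨n, hn, rfl⟩ := hm
            rw [Finset.mem_filter, Finset.mem_Icc] at hn
            obtain ⟨⟨hn1, _⟩, rfl⟩ := hn
            have hn0 : n ≠ 0 := by omega
            refine ⟨(Nat.div_pos (Nat.le_of_dvd hn1 (hrd n)) (Nat.pos_of_ne_zero hl0)).ne', ?_⟩
            refine (Nat.primeFactors_mono (Nat.div_dvd_of_dvd (hrd n)) hn0).trans ?_
            rw [Nat.primeFactors_mul hl0 hq, hrp]
            intro p hp
            by_cases hpq : p ∈ q.primeFactors <;> simp_all)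
        rw [h1]
        calc _ ≤ (l : ℝ)⁻¹ * (((l * q : ℕ) : ℝ) / ((l * q).totient : ℝ)) := by gcongr
          _ = _ := by
            rw [Nat.totient_mul hl'.2.2]
            push_cast
            field_simp
    _ = _ := by rw [sieveMass, Finset.sum_mul]

/-- The primes up to `n`. -/
def primesUpTo (n : ℕ) : Finset ℕ := Finset.filter Nat.Prime (Finset.range (n + 1))

lemma mem_primesUpTo {n p : ℕ} : p ∈ primesUpTo n ↔ p ≤ n ∧ p.Prime := by
  simp [primesUpTo]

lemma mul_log_div_sub_one_le {n p : ℕ} (hp : p.Prime) (hpn : p ≤ n) :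
    n * (Real.log p / (p - 1)) ≤ n.factorial.factorization p * Real.log p + 2 * Real.log n := by
  have := Fact.mk hp
  have hn0 : n ≠ 0 := by have := hp.pos; omega
  have hp1 : (0 : ℝ) < p - 1 := by
    have : (1 : ℝ) < p := by exact_mod_cast hp.one_lt
    linarith
  have hlog : 0 ≤ Real.log p := Real.log_natCast_nonneg p
  have hlen : (p.digits n).length = Nat.log p n + 1 := Nat.length_digits p n hp.one_lt hn0
  have hsum : (p.digits n).sum ≤ (Nat.log p n + 1) * (p - 1) := by
    have := List.sum_le_card_nsmul (p.digits n) (p - 1) fun d hd => by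
      have := Nat.digits_lt_base hp.one_lt hd
      omega
    rwa [hlen, smul_eq_mul] at this
  have hleg := sub_one_mul_padicValNat_factorial (p := p) n
  have hle : n ≤ (p - 1) * (n.factorial.factorization p + (Nat.log p n + 1)) := by
    rw [Nat.factorization_def _ hp, mul_add, hleg, mul_comm (p - 1)]
    omega
  have hleR : (n : ℝ) ≤ (p - 1) * (n.factorial.factorization p + (Nat.log p n + 1)) := by
    have h : ((p - 1 : ℕ) : ℝ) = p - 1 := by
      rw [Nat.cast_sub hp.one_le, Nat.cast_one]
    rw [← h]
    exact_mod_cast hle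
  have hL : (Nat.log p n : ℝ) * Real.log p ≤ Real.log n := by
    rw [← Real.log_pow]
    apply Real.log_le_log
    · have := hp.pos; positivity
    · exact_mod_cast Nat.pow_log_le_self p hn0
  have hpl : Real.log p ≤ Real.log n :=
    Real.log_le_log (by exact_mod_cast hp.pos) (by exact_mod_cast hpn)
  calc n * (Real.log p / (p - 1))
      ≤ ((p - 1) * (n.factorial.factorization p + (Nat.log p n + 1))) *
        (Real.log p / (p - 1)) := by gcongr
    _ = n.factorial.factorization p * Real.log p + (Nat.log p n * Real.log p + Real.log p) := by
        field_simp
    _ ≤ _ := by linarith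

lemma eventually_sum_log_div_sub_one_le :
    ∀ᶠ x : ℝ in Filter.atTop,
      ∑ p ∈ primesUpTo ⌊x⌋₊, Real.log p / ((p : ℝ) - 1) ≤ Real.log x + 12 := by
  have hpi := Chebyshev.eventually_primeCounting_le one_pos
  have hpi' := (tendsto_natCast_atTop_atTop (R := ℝ)).comp
    (tendsto_nat_floor_atTop (α := ℝ)) |>.eventually hpi
  filter_upwards [hpi', Filter.eventually_ge_atTop 2] with x hx hx2
  set n := ⌊x⌋₊ with hn
  have hn2 : 2 ≤ n := Nat.le_floor (by exact_mod_cast hx2)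
  have hnR : (0 : ℝ) < n := by positivity
  have hnx : (n : ℝ) ≤ x := Nat.floor_le (by linarith)
  have hlogn : 0 < Real.log n := Real.log_pos (by exact_mod_cast hn2)
  simp only [Function.comp_apply, Nat.floor_natCast] at hx
  rw [← hn, le_div_iff₀ hlogn] at hx
  have hcard : ((primesUpTo n).card : ℝ) = Nat.primeCounting n := by
    rw [Nat.primeCounting, Nat.primeCounting', Nat.count_eq_card_filter_range, primesUpTo]
  have hfac : ∑ p ∈ primesUpTo n, (n.factorial.factorization p : ℝ) * Real.log p
      = Real.log n.factorial := by
    conv_rhs => rw [← Nat.prod_factorization_pow_eq_self n.factorial_ne_zero]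
    rw [Finsupp.prod, Nat.cast_prod, Real.log_prod]
    · have hsub : n.factorial.factorization.support ⊆ primesUpTo n := by
        intro p hp
        rw [Nat.support_factorization] at hp
        have h1 := Nat.prime_of_mem_primeFactors hp
        exact mem_primesUpTo.2 ⟨(h1.dvd_factorial).1 (Nat.dvd_of_mem_primeFactors hp), h1⟩
      rw [← Finset.sum_subset hsub]
      · refine Finset.sum_congr rfl fun p _ => ?_
        rw [Nat.cast_pow, Real.log_pow]
      · intro p _ hp
        rw [Finsupp.notMem_support_iff] at hp
        simp [hp]
    · intro p hp
      rw [Nat.support_factorization] at hp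
      have := (Nat.prime_of_mem_primeFactors hp).pos
      positivity
  have hfl : Real.log n.factorial ≤ n * Real.log n := by
    rw [← Real.log_pow]
    apply Real.log_le_log (by exact_mod_cast n.factorial_pos)
    exact_mod_cast Nat.factorial_le_pow n
  have hmain : n * ∑ p ∈ primesUpTo n, Real.log p / ((p : ℝ) - 1)
      ≤ n * Real.log n + 2 * ((Real.log 4 + 1) * n) := by
    rw [Finset.mul_sum]
    calc _ ≤ ∑ p ∈ primesUpTo n,
          ((n.factorial.factorization p : ℝ) * Real.log p + 2 * Real.log n) :=
          Finset.sum_le_sum fun p hp =>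
            mul_log_div_sub_one_le (mem_primesUpTo.1 hp).2 (mem_primesUpTo.1 hp).1
      _ = Real.log n.factorial + 2 * (Nat.primeCounting n * Real.log n) := by
          rw [Finset.sum_add_distrib, hfac, Finset.sum_const, nsmul_eq_mul, hcard]
          ring
      _ ≤ _ := by linarith
  have h4 : Real.log 4 ≤ 3 := by
    have := Real.log_le_sub_one_of_pos (show (0 : ℝ) < 4 by norm_num)
    linarith
  have hlx : Real.log n ≤ Real.log x := Real.log_le_log hnR hnx
  have : ∑ p ∈ primesUpTo n, Real.log p / ((p : ℝ) - 1) ≤ Real.log n + 2 * (Real.log 4 + 1) := by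
    refine le_of_mul_le_mul_left ?_ hnR
    linarith
  linarith

lemma inv_one_sub_inv_le {p : ℕ} (hp : p.Prime) {δ : ℝ} (hδ : 0 < δ) :
    (1 - (p : ℝ)⁻¹)⁻¹ ≤
      (1 - (p : ℝ) ^ (-(1 + δ)))⁻¹ * Real.exp (δ * (Real.log p / (p - 1))) := by
  have hp1 : (1 : ℝ) < p := by exact_mod_cast hp.one_lt
  have hp0 : (0 : ℝ) < p := by linarith
  have hpm : (0 : ℝ) < p - 1 := by linarith
  have h1 : (0 : ℝ) < 1 - (p : ℝ)⁻¹ := by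
    have := inv_lt_one_of_one_lt₀ hp1
    linarith
  have h2 : (0 : ℝ) < 1 - (p : ℝ) ^ (-(1 + δ)) := by
    have := Real.rpow_lt_one_of_one_lt_of_neg hp1 (show -(1 + δ) < 0 by linarith)
    linarith
  have h3 : (p : ℝ) ^ (-(1 + δ)) = (p : ℝ)⁻¹ * Real.exp (-(δ * Real.log p)) := by
    rw [neg_add, Real.rpow_add hp0, Real.rpow_neg_one, Real.rpow_def_of_pos hp0 (-δ)]
    congr 2
    ring
  have h4 := Real.add_one_le_exp (-(δ * Real.log p))
  have h5 := Real.add_one_le_exp (δ * (Real.log p / (p - 1)))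
  have h6 : 1 - (p : ℝ) ^ (-(1 + δ)) ≤ (1 - (p : ℝ)⁻¹) * Real.exp (δ * (Real.log p / (p - 1))) := by
    calc 1 - (p : ℝ) ^ (-(1 + δ)) ≤ 1 - (p : ℝ)⁻¹ * (-(δ * Real.log p) + 1) := by
          rw [h3]; gcongr
      _ = (1 - (p : ℝ)⁻¹) * (δ * (Real.log p / (p - 1)) + 1) := by
          field_simp
          ring
      _ ≤ _ := by gcongr
  rw [inv_mul_eq_div, inv_eq_one_div, div_le_div_iff₀ h1 h2]
  linarith

lemma eventually_prod_inv_one_sub_inv_le :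
    ∀ᶠ x : ℝ in Filter.atTop,
      ∏ p ∈ primesUpTo ⌊x⌋₊, (1 - (p : ℝ)⁻¹)⁻¹ ≤ 2.8 * Real.log x := by
  have hδ0 : Filter.Tendsto (fun x : ℝ => (Real.log x)⁻¹) Filter.atTop (nhds 0) :=
    Real.tendsto_log_atTop.inv_tendsto_atTop
  have hs : Filter.Tendsto (fun x : ℝ => 1 + (Real.log x)⁻¹) Filter.atTop
      (nhdsWithin 1 (Set.Ioi 1)) := by
    rw [tendsto_nhdsWithin_iff]
    refine ⟨by simpa using hδ0.const_add 1, ?_⟩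
    filter_upwards [Filter.eventually_gt_atTop 1] with x hx
    have := Real.log_pos hx
    simp only [Set.mem_Ioi, lt_add_iff_pos_right]
    positivity
  have hz := tendsto_sub_mul_tsum_nat_rpow.comp hs
  have he : Filter.Tendsto (fun x : ℝ => Real.exp (1 + 12 * (Real.log x)⁻¹)) Filter.atTop
      (nhds (Real.exp 1)) := by
    have : Filter.Tendsto (fun x : ℝ => 1 + 12 * (Real.log x)⁻¹) Filter.atTop (nhds 1) := by
      simpa using (hδ0.const_mul 12).const_add 1
    exact (Real.continuous_exp.tendsto 1).comp this
  have hlim := hz.mul he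
  have hlt : 1 * Real.exp 1 < 2.8 := by
    have := Real.exp_one_lt_d9
    norm_num
    linarith
  filter_upwards [hlim.eventually (eventually_lt_nhds hlt), eventually_sum_log_div_sub_one_le,
    Filter.eventually_gt_atTop 1] with x hx hsum hx1
  have hlog : 0 < Real.log x := Real.log_pos hx1
  simp only [Function.comp_apply] at hx
  set δ := (Real.log x)⁻¹ with hδ
  have hδpos : 0 < δ := inv_pos.2 hlog
  have hδl : δ * Real.log x = 1 := inv_mul_cancel₀ hlog.ne'
  set ζ := ∑' n : ℕ, 1 / (n : ℝ) ^ (1 + δ) with hζ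
  have hsm : Summable (fun n : ℕ => 1 / (n : ℝ) ^ (1 + δ)) :=
    Real.summable_one_div_nat_rpow.2 (by linarith)
  have hprod : ∏ p ∈ primesUpTo ⌊x⌋₊, (1 - (p : ℝ) ^ (-(1 + δ)))⁻¹ ≤ ζ := by
    have h := hasSum_factoredNumbers_rpow (s := 1 + δ) (by linarith) (Finset.range (⌊x⌋₊ + 1))
    change HasSum _ (∏ p ∈ primesUpTo ⌊x⌋₊, (1 - (p : ℝ) ^ (-(1 + δ)))⁻¹) at h
    rw [← h.tsum_eq, hζ]
    have heq : ∀ n : ℕ, (n : ℝ) ^ (-(1 + δ)) = 1 / (n : ℝ) ^ (1 + δ) := fun n => by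
      rw [Real.rpow_neg (Nat.cast_nonneg n), one_div]
    simp only [heq]
    exact Summable.tsum_subtype_le (fun n : ℕ => 1 / (n : ℝ) ^ (1 + δ)) _
      (fun n => by positivity) hsm
  have hζ0 : 0 ≤ ζ := tsum_nonneg fun n => by positivity
  calc ∏ p ∈ primesUpTo ⌊x⌋₊, (1 - (p : ℝ)⁻¹)⁻¹
      ≤ ∏ p ∈ primesUpTo ⌊x⌋₊, ((1 - (p : ℝ) ^ (-(1 + δ)))⁻¹ *
          Real.exp (δ * (Real.log p / (p - 1)))) := by
        refine Finset.prod_le_prod (fun p hp => ?_) fun p hp =>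
          inv_one_sub_inv_le (mem_primesUpTo.1 hp).2 hδpos
        have : (1 : ℝ) < p := by exact_mod_cast (mem_primesUpTo.1 hp).2.one_lt
        have := inv_lt_one_of_one_lt₀ this
        exact inv_nonneg.2 (by linarith)
    _ = (∏ p ∈ primesUpTo ⌊x⌋₊, (1 - (p : ℝ) ^ (-(1 + δ)))⁻¹) *
          Real.exp (δ * ∑ p ∈ primesUpTo ⌊x⌋₊, Real.log p / ((p : ℝ) - 1)) := by
        rw [Finset.prod_mul_distrib, Finset.mul_sum, Real.exp_sum]
    _ ≤ ζ * Real.exp (δ * (Real.log x + 12)) := by gcongr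
    _ = ((1 + δ - 1) * ζ * Real.exp (1 + 12 * δ)) * Real.log x := by
        rw [mul_add, hδl, mul_comm δ 12]
        linear_combination (-ζ * Real.exp (1 + 12 * δ)) * hδl
    _ ≤ 2.8 * Real.log x := by gcongr

lemma primorialBelow_eq (x : ℝ) : primorialBelow x = ∏ p ∈ primesUpTo ⌊x⌋₊, p := rfl

lemma primorialBelow_pos (x : ℝ) : 0 < primorialBelow x :=
  Finset.prod_pos fun _ hp => (mem_primesUpTo.1 hp).2.pos

lemma dvd_primorialBelow {x : ℝ} (hx : 0 ≤ x) {p : ℕ} (hp : p.Prime) (hpx : (p : ℝ) ≤ x) :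
    p ∣ primorialBelow x :=
  Finset.dvd_prod_of_mem _ (mem_primesUpTo.2 ⟨(Nat.le_floor_iff hx).2 hpx, hp⟩)

lemma primeFactors_primorialBelow (x : ℝ) : (primorialBelow x).primeFactors = primesUpTo ⌊x⌋₊ :=
  Nat.primeFactors_prod fun _ hp => (mem_primesUpTo.1 hp).2

lemma div_totient_le_of_dvd_primorialBelow {x : ℝ} {q : ℕ} (hq : q ∣ primorialBelow x) :
    (q : ℝ) / q.totient ≤ ∏ p ∈ primesUpTo ⌊x⌋₊, (1 - (p : ℝ)⁻¹)⁻¹ := by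
  have hP := (primorialBelow_pos x).ne'
  rw [div_totient_eq_prod (ne_zero_of_dvd_ne_zero hP hq), ← primeFactors_primorialBelow]
  have key : ∀ p : ℕ, p.Prime → 1 ≤ (1 - (p : ℝ)⁻¹)⁻¹ := fun p hp => by
    have hp1 : (1 : ℝ) < p := by exact_mod_cast hp.one_lt
    have h1 := inv_lt_one_of_one_lt₀ hp1
    have h2 : 0 < (p : ℝ)⁻¹ := by positivity
    exact (one_le_inv₀ (by linarith)).2 (by linarith)
  refine Finset.prod_le_prod_of_subset_of_one_le (Nat.primeFactors_mono hq hP) ?_ ?_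
  · intro p hp
    linarith [key p (Nat.prime_of_mem_primeFactors hp)]
  · intro p hp _
    exact key p (Nat.prime_of_mem_primeFactors hp)

/-- Removing a prime factor from the primorial leaves something that still tends to infinity. -/
lemma exists_forall_le_primorialBelow_div (M : ℕ) :
    ∃ x₀ : ℝ, ∀ x : ℝ, x₀ ≤ x → ∀ B : ℕ, (B = 1 ∨ (B.Prime ∧ (B : ℝ) ≤ x)) →
      primorialBelow x / B ∣ primorialBelow x ∧ M ≤ primorialBelow x / B := by
  obtain ⟨p₁, h1, hp1⟩ := Nat.exists_infinite_primes M
  obtain ⟨p₂, h2, hp2⟩ := Nat.exists_infinite_primes (p₁ + 1)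
  refine ⟨p₂, fun x hx B hB => ?_⟩
  have hx0 : 0 ≤ x := (Nat.cast_nonneg p₂).trans hx
  have hp1x : (p₁ : ℝ) ≤ x := by
    have : (p₁ : ℝ) ≤ p₂ := by exact_mod_cast (by omega : p₁ ≤ p₂)
    linarith
  have hBd : B ∣ primorialBelow x := by
    rcases hB with rfl | ⟨hB, hBx⟩
    · exact one_dvd _
    · exact dvd_primorialBelow hx0 hB hBx
  refine ⟨Nat.div_dvd_of_dvd hBd, ?_⟩
  have hpos : 0 < primorialBelow x / B := Nat.div_pos (Nat.le_of_dvd (primorialBelow_pos x) hBd)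
    (Nat.pos_of_dvd_of_pos hBd (primorialBelow_pos x))
  have key : ∀ p : ℕ, p.Prime → (p : ℝ) ≤ x → p ≠ B → p ≤ primorialBelow x / B := by
    intro p hp hpx hpB
    have hd := dvd_primorialBelow hx0 hp hpx
    rw [← Nat.div_mul_cancel hBd, hp.dvd_mul] at hd
    rcases hd with h | h
    · exact Nat.le_of_dvd hpos h
    · rcases hB with rfl | ⟨hB, _⟩
      · exact absurd (Nat.dvd_one.1 h) hp.one_lt.ne'
      · exact absurd ((Nat.prime_dvd_prime_iff_eq hp hB).1 h) hpB
  by_cases h : p₁ = B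
  · have := key p₂ hp2 hx (by omega)
    omega
  · have := key p₁ hp1 hp1x h
    omega

/-- A Brun–Titchmarsh inequality with explicit sifting level `R`. -/
lemma ncard_prime_progression_le {q R : ℕ} (hq : 0 < q) (hR : 1 ≤ R) {Z : ℝ} (hZ : 0 ≤ Z) {b : ℤ}
    (hb : 1 ≤ b) :
    (({z : ℤ | 1 ≤ z ∧ (z : ℝ) ≤ Z ∧ Prime ((q : ℤ) * z + b)}.ncard : ℝ))
      ≤ Z * (q / q.totient) / Real.log (R + 1) + R + (R : ℝ) ^ 2 := by
  set N := ⌊Z⌋₊ with hN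
  set T := {z ∈ Finset.Ioc (0 : ℤ) N | ∀ d ∈ sieveSupport q R, (d : ℤ) ∣ q * z + b → d = 1}
    with hT
  have hsub : {z : ℤ | 1 ≤ z ∧ (z : ℝ) ≤ Z ∧ Prime ((q : ℤ) * z + b)}
      ⊆ ((Finset.Ioc (0 : ℤ) R ∪ T : Finset ℤ) : Set ℤ) := by
    rintro z ⟨hz1, hzZ, hpr⟩
    rw [Finset.mem_coe, Finset.mem_union]
    by_cases hzR : z ≤ R
    · left
      rw [Finset.mem_Ioc]
      omega
    · right
      rw [hT, Finset.mem_filter, Finset.mem_Ioc]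
      refine ⟨⟨by omega, ?_⟩, ?_⟩
      · lift z to ℕ using by omega
        have : z ≤ N := Nat.le_floor (by exact_mod_cast hzZ)
        exact_mod_cast this
      · intro d hd hdvd
        have hq' : (1 : ℤ) ≤ q := by exact_mod_cast hq
        have hbig : (R : ℤ) < q * z + b := by nlinarith
        have hp := Int.prime_iff_natAbs_prime.1 hpr
        rcases (Nat.dvd_prime hp).1 (Int.natCast_dvd.1 hdvd) with h | h
        · exact h
        · have := (mem_sieveSupport.1 hd).1.2
          omega
  have hcard := Set.ncard_le_ncard hsub (Finset.finite_toSet _)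
  rw [Set.ncard_coe_finset] at hcard
  have hcard' := hcard.trans (Finset.card_union_le _ _)
  rw [Int.card_Ioc] at hcard'
  have h1 : (({z : ℤ | 1 ≤ z ∧ (z : ℝ) ≤ Z ∧ Prime ((q : ℤ) * z + b)}.ncard : ℝ)) ≤ R + T.card := by
    simp only [sub_zero, Int.toNat_natCast] at hcard'
    exact_mod_cast hcard'
  have h2 := selberg_sieve_progression (q := q) hR b N
  rw [← hT] at h2
  have hJ := sieveMass_pos (q := q) hR
  have hlog : 0 < Real.log (R + 1) := Real.log_pos (by
    have : (1 : ℝ) ≤ R := by exact_mod_cast hR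
    linarith)
  have h3 : (N : ℝ) / sieveMass q R ≤ Z * (q / q.totient) / Real.log (R + 1) := by
    rw [div_le_div_iff₀ hJ hlog]
    have hNZ : (N : ℝ) ≤ Z := Nat.floor_le hZ
    have h := log_le_sieveMass_mul (q := q) (R := R) hq.ne'
    calc (N : ℝ) * Real.log (R + 1) ≤ Z * (sieveMass q R * (q / q.totient)) := by gcongr
      _ = _ := by ring
  linarith

lemma const_lt_four_mul_exp_eulerMascheroniConstant :
    6.55 < 4 * Real.exp Real.eulerMascheroniConstant := by
  have h1 : Real.exp (1 / 2) < Real.exp Real.eulerMascheroniConstant :=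
    Real.exp_lt_exp.2 Real.one_half_lt_eulerMascheroniConstant
  have h2 : Real.exp (1 / 2) * Real.exp (1 / 2) = Real.exp 1 := by
    rw [← Real.exp_add]
    norm_num
  have h3 := Real.exp_one_gt_d9
  have h4 := Real.exp_pos (1 / 2)
  have h5 : 1.64 < Real.exp (1 / 2) := by
    by_contra! h
    nlinarith
  linarith

lemma eventually_sifting_error_le :
    ∀ᶠ Z : ℝ in Filter.atTop, 2 * Z ^ (0.9 : ℝ) ≤ 0.3 * (Z / Real.log Z) := by
  have h := (isLittleO_log_rpow_atTop (show (0 : ℝ) < 0.1 by norm_num)).bound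
    (show (0 : ℝ) < 0.15 by norm_num)
  filter_upwards [h, Filter.eventually_gt_atTop 1] with Z hZ hZ1
  have hZ0 : 0 < Z := by linarith
  have hlog := Real.log_pos hZ1
  rw [Real.norm_of_nonneg hlog.le, Real.norm_of_nonneg (by positivity)] at hZ
  have hmul : Z ^ (0.9 : ℝ) * Z ^ (0.1 : ℝ) = Z := by
    rw [← Real.rpow_add hZ0]
    norm_num
  rw [← mul_div_assoc, le_div_iff₀ hlog]
  calc 2 * Z ^ (0.9 : ℝ) * Real.log Z ≤ 2 * Z ^ (0.9 : ℝ) * (0.15 * Z ^ (0.1 : ℝ)) := by gcongr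
    _ = 0.3 * (Z ^ (0.9 : ℝ) * Z ^ (0.1 : ℝ)) := by ring
    _ = _ := by rw [hmul]

/-- Brun–Titchmarsh type upper bound: for `P = P(x)/B₀` with `B₀` either `1` or a prime
`≤ x`, `Z ≥ P` and `1 ≤ b ≤ PZ` with `gcd(b, P) = 1`, the number of `z ∈ [Z]` with
`Pz + b` prime is at most `(4e^γ + ε)·(log x / log Z)·Z`. -/
theorem primes_in_AP_upper_bound (ε : ℝ) (hε : 0 < ε) :
    ∃ x₀ : ℝ, ∀ x : ℝ, x₀ ≤ x → ∀ B₀ : ℕ,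
      (B₀ = 1 ∨ (Nat.Prime B₀ ∧ (B₀ : ℝ) ≤ x)) →
      (let P : ℕ := primorialBelow x / B₀
      ∀ Z : ℝ, (P : ℝ) ≤ Z →
        ∀ b : ℤ, 1 ≤ b → (b : ℝ) ≤ (P : ℝ) * Z → Int.gcd b (P : ℤ) = 1 →
          (({z : ℤ | 1 ≤ z ∧ (z : ℝ) ≤ Z ∧ Prime ((P : ℤ) * z + b)}.ncard : ℝ))
            ≤ (4 * Real.exp Real.eulerMascheroniConstant + ε) *
              (Real.log x / Real.log Z) * Z) := by
  obtain ⟨Z₀, hZ₀⟩ := Filter.eventually_atTop.1 eventually_sifting_error_le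
  obtain ⟨x₁, hx₁⟩ := Filter.eventually_atTop.1 eventually_prod_inv_one_sub_inv_le
  obtain ⟨x₂, hx₂⟩ := exists_forall_le_primorialBelow_div (max 2 ⌈Z₀⌉₊)
  refine ⟨max (Real.exp 1) (max x₁ x₂), fun x hx B₀ hB₀ => ?_⟩
  simp only [max_le_iff] at hx
  obtain ⟨hxe, hxx₁, hxx₂⟩ := hx
  intro P Z hPZ b hb _ _
  obtain ⟨hPd, hPM⟩ : P ∣ primorialBelow x ∧ max 2 ⌈Z₀⌉₊ ≤ P := hx₂ x hxx₂ B₀ hB₀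
  rw [max_le_iff] at hPM
  have hV := (div_totient_le_of_dvd_primorialBelow hPd).trans (hx₁ x hxx₁)
  have hP2 : (2 : ℝ) ≤ P := by exact_mod_cast hPM.1
  have hZ2 : 2 ≤ Z := hP2.trans hPZ
  have hZ00 : Z₀ ≤ Z := by
    have : (⌈Z₀⌉₊ : ℝ) ≤ P := by exact_mod_cast hPM.2
    exact (Nat.le_ceil Z₀).trans (this.trans hPZ)
  have hE := hZ₀ Z hZ00
  have hZ0 : 0 < Z := by linarith
  have hlogZ : 0 < Real.log Z := Real.log_pos (by linarith)
  have hlogx : 1 ≤ Real.log x := by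
    rw [Real.le_log_iff_exp_le ((Real.exp_pos 1).trans_le hxe)]
    exact hxe
  set R := ⌊Z ^ (0.45 : ℝ)⌋₊ with hRdef
  have hY1 : 1 ≤ Z ^ (0.45 : ℝ) := Real.one_le_rpow (by linarith) (by norm_num)
  have hR : 1 ≤ R := Nat.le_floor (by exact_mod_cast hY1)
  have hRle : (R : ℝ) ≤ Z ^ (0.45 : ℝ) := Nat.floor_le (by linarith)
  have hR1 : (1 : ℝ) ≤ R := by exact_mod_cast hR
  have hRsq : (R : ℝ) ^ 2 ≤ Z ^ (0.9 : ℝ) := by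
    calc (R : ℝ) ^ 2 ≤ (Z ^ (0.45 : ℝ)) ^ 2 := by gcongr
      _ = Z ^ (0.9 : ℝ) := by
        rw [← Real.rpow_natCast, ← Real.rpow_mul hZ0.le]
        norm_num
  have hlogR : 0.45 * Real.log Z ≤ Real.log (R + 1) := by
    rw [← Real.log_rpow hZ0]
    exact Real.log_le_log (by positivity) (Nat.lt_floor_add_one _).le
  have hPpos : 0 < P := by omega
  calc (({z : ℤ | 1 ≤ z ∧ (z : ℝ) ≤ Z ∧ Prime ((P : ℤ) * z + b)}.ncard : ℝ))
      ≤ Z * (P / P.totient) / Real.log (R + 1) + R + (R : ℝ) ^ 2 :=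
        ncard_prime_progression_le hPpos hR hZ0.le hb
    _ ≤ Z * (2.8 * Real.log x) / (0.45 * Real.log Z) + 2 * Z ^ (0.9 : ℝ) := by
        have : Z * (P / P.totient) / Real.log (R + 1)
            ≤ Z * (2.8 * Real.log x) / (0.45 * Real.log Z) := by gcongr
        nlinarith
    _ ≤ Z * (2.8 * Real.log x) / (0.45 * Real.log Z) + 0.3 * (Z / Real.log Z) * Real.log x := by
        have : 0.3 * (Z / Real.log Z) ≤ 0.3 * (Z / Real.log Z) * Real.log x :=
          le_mul_of_one_le_right (by positivity) hlogx
        linarith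
    _ = (2.8 / 0.45 + 0.3) * (Real.log x / Real.log Z) * Z := by
        field_simp
    _ ≤ _ := by
        have := const_lt_four_mul_exp_eulerMascheroniConstant
        have hc : (2.8 / 0.45 + 0.3 : ℝ) ≤ 4 * Real.exp Real.eulerMascheroniConstant + ε := by
          have : (2.8 / 0.45 + 0.3 : ℝ) ≤ 6.55 := by norm_num
          linarith
        gcongr
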